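/- arXiv:1701.06191 — 2 statements merged into one kernel-verified Lean document; each statement's English description precedes it below -/
import Mathlib

section
/- Let f be a bounded measurable function on a probability space with entropy S_f(β) = β E_{βf}[f] - ln Z_{βf}, where Z_{βf} = E[e^{βf}] and E_{βf}[g] = E[g e^{βf}]/Z_{βf}. Then for every β > 0, ln E[e^{β(f - E[f])}] = β ∫₀^β S_f(γ)/γ² dγ. -/
open MeasureTheory

theorem stmt_8 {Ω : Type*} [MeasurableSpace Ω] (μ : Measure Ω) [IsProbabilityMeasure μ]
    (f : Ω → ℝ) (hf : Measurable f) (C : ℝ) (hb : ∀ x, |f x| ≤ C)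
    (β : ℝ) (hβ : 0 < β) :
    Real.log (∫ x, Real.exp (β * (f x - ∫ y, f y ∂μ)) ∂μ)
      = β * ∫ γ in (0:ℝ)..β,
          (γ * ((∫ x, f x * Real.exp (γ * f x) ∂μ) / ∫ x, Real.exp (γ * f x) ∂μ)
            - Real.log (∫ x, Real.exp (γ * f x) ∂μ)) / γ ^ 2 := by
  have hint : ∀ t : ℝ, Integrable (fun x => Real.exp (t * f x)) μ := by
    intro t
    refine Integrable.of_bound (C := Real.exp (|t| * C)) (by fun_prop) ?_
    filter_upwards with x
    rw [Real.norm_eq_abs, abs_of_pos (Real.exp_pos _), Real.exp_le_exp]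
    calc t * f x ≤ |t * f x| := le_abs_self _
      _ = |t| * |f x| := abs_mul _ _
      _ ≤ |t| * C := mul_le_mul_of_nonneg_left (hb x) (abs_nonneg _)
  have hset : ∀ t : ℝ, t ∈ interior (ProbabilityTheory.integrableExpSet f μ) := by
    intro t
    have : ProbabilityTheory.integrableExpSet f μ = Set.univ := by
      ext s; simpa [ProbabilityTheory.integrableExpSet] using hint s
    simp [this]
  have hpos : ∀ t : ℝ, 0 < ∫ x, Real.exp (t * f x) ∂μ := fun t => integral_exp_pos (hint t)
  set K := ProbabilityTheory.cgf f μ with hK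
  have hKa : ∀ t, AnalyticAt ℝ K t := fun t => ProbabilityTheory.analyticAt_cgf (hset t)
  have hK0 : K 0 = 0 := ProbabilityTheory.cgf_zero
  have hdK0 : deriv K 0 = ∫ y, f y ∂μ := by
    rw [hK, ProbabilityTheory.deriv_cgf_zero (hset 0)]; simp
  have hKeq : ∀ t, K t = Real.log (∫ x, Real.exp (t * f x) ∂μ) := fun t => rfl
  have hdK : ∀ t, deriv K t = (∫ x, f x * Real.exp (t * f x) ∂μ) / ∫ x, Real.exp (t * f x) ∂μ :=
    fun t => ProbabilityTheory.deriv_cgf (hset t)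
  have hGe : ∀ t : ℝ, t ≠ 0 → dslope K 0 =ᶠ[nhds t] fun s => K s / s := by
    intro t ht
    filter_upwards [isOpen_ne.mem_nhds ht] with s hs
    rw [dslope_of_ne _ hs, slope_def_field, hK0]; simp
  have hGa : ∀ t, AnalyticAt ℝ (dslope K 0) t := by
    intro t
    by_cases ht : t = 0
    · subst ht
      obtain ⟨p, hp⟩ := hKa 0
      exact ⟨_, hp.has_fpower_series_dslope_fslope⟩
    · exact ((hKa t).div analyticAt_id ht).congr (hGe t ht).symm
  have hdG : ∀ t : ℝ, t ≠ 0 → deriv (dslope K 0) t = (t * deriv K t - K t) / t ^ 2 := by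
    intro t ht
    rw [(hGe t ht).deriv_eq]
    have := ((hKa t).differentiableAt.hasDerivAt.div (hasDerivAt_id t) ht).deriv
    rw [show (fun s => K s / s) = K / id from rfl, this]
    simp [mul_comm]
  have hcont : Continuous (deriv (dslope K 0)) :=
    continuous_iff_continuousAt.2 fun t => (hGa t).deriv.continuousAt
  have hI := intervalIntegral.integral_deriv_eq_sub (a := 0) (b := β) (f := dslope K 0)
    (fun t _ => (hGa t).differentiableAt) (hcont.intervalIntegrable _ _)
  have hcongr : (∫ γ in (0:ℝ)..β,
          (γ * ((∫ x, f x * Real.exp (γ * f x) ∂μ) / ∫ x, Real.exp (γ * f x) ∂μ)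
            - Real.log (∫ x, Real.exp (γ * f x) ∂μ)) / γ ^ 2)
      = ∫ γ in (0:ℝ)..β, deriv (dslope K 0) γ := by
    refine intervalIntegral.integral_congr_ae (Filter.Eventually.of_forall fun t ht => ?_)
    rw [Set.uIoc_of_le hβ.le] at ht
    rw [hdG t ht.1.ne', hdK, hKeq]
  rw [hcongr, hI, dslope_same, hdK0, (hGe β hβ.ne').eq_of_nhds, hKeq]
  have : ∀ x, Real.exp (β * (f x - ∫ y, f y ∂μ))
      = Real.exp (β * f x) * Real.exp (-(β * ∫ y, f y ∂μ)) := by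
    intro x; rw [← Real.exp_add]; ring_nf
  simp_rw [this]
  rw [integral_mul_const, Real.log_mul (hpos β).ne' (Real.exp_pos _).ne', Real.log_exp]
  field_simp
  ring
end

section
/- Efron–Stein inequality: for independent random variables X₁,...,Xₙ and an independent copy X', and bounded measurable f, σ²(f(X)) ≤ (1/2)Σ_{k=1}^n E[(f(X) - f(X^{(k)}))²], where X^{(k)} is X with the k-th coordinate replaced by X'_k. -/
open MeasureTheory

namespace EfronStein

variable {n : ℕ} {Ω : Fin n → Type*}

/-- Swap the coordinates in `S`. -/
def sw (S : Finset (Fin n)) (p : (∀ k, Ω k) × (∀ k, Ω k)) : (∀ k, Ω k) × (∀ k, Ω k) :=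
  (fun i => if i ∈ S then p.2 i else p.1 i, fun i => if i ∈ S then p.1 i else p.2 i)

theorem measurable_sw [∀ k, MeasurableSpace (Ω k)] (S : Finset (Fin n)) :
    Measurable (sw (Ω := Ω) S) := by
  refine Measurable.prodMk ?_ ?_ <;> refine measurable_pi_lambda _ fun i => ?_ <;>
    by_cases h : i ∈ S <;> simp only [h, if_true, if_false] <;> fun_prop

theorem mp_sw [∀ k, MeasurableSpace (Ω k)]
    (μ : ∀ k, Measure (Ω k)) [∀ k, IsProbabilityMeasure (μ k)] (S : Finset (Fin n)) :
    MeasurePreserving (sw (Ω := Ω) S) ((Measure.pi μ).prod (Measure.pi μ))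
      ((Measure.pi μ).prod (Measure.pi μ)) := by
  refine ⟨measurable_sw S, ?_⟩
  symm
  have hs : (Measure.pi μ).FiniteSpanningSetsIn
      (Set.pi Set.univ '' Set.pi Set.univ fun i => {s : Set (Ω i) | MeasurableSet s}) :=
    { set := fun _ => Set.univ
      set_mem := fun _ => ⟨fun _ => Set.univ, fun i _ => MeasurableSet.univ, by simp⟩
      finite := fun _ => by simp
      spanning := by simp [Set.iUnion_const] }
  refine Measure.prod_eq_generateFrom generateFrom_pi generateFrom_pi isPiSystem_pi isPiSystem_pi
    hs hs ?_
  rintro _ ⟨s, hs, rfl⟩ _ ⟨t, ht, rfl⟩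
  have hs' : ∀ i, MeasurableSet (s i) := fun i => hs i trivial
  have ht' : ∀ i, MeasurableSet (t i) := fun i => ht i trivial
  rw [Measure.map_apply (measurable_sw S)
    ((MeasurableSet.univ_pi hs').prod (MeasurableSet.univ_pi ht'))]
  have : sw S ⁻¹' (Set.pi Set.univ s ×ˢ Set.pi Set.univ t) =
      (Set.pi Set.univ fun i => if i ∈ S then t i else s i) ×ˢ
      (Set.pi Set.univ fun i => if i ∈ S then s i else t i) := by
    ext p
    simp only [sw, Set.mem_preimage, Set.mem_prod, Set.mem_pi, Set.mem_univ, true_imp_iff,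
      ← forall_and]
    refine forall_congr' fun i => ?_
    by_cases h : i ∈ S <;> simp [h, and_comm]
  rw [this, Measure.prod_prod]
  simp only [Measure.pi_pi, ← Finset.prod_mul_distrib]
  refine Finset.prod_congr rfl fun i _ => ?_
  by_cases h : i ∈ S <;> simp [h, mul_comm]

theorem sw_single_fst (k : Fin n) (p : (∀ k, Ω k) × (∀ k, Ω k)) :
    (sw {k} p).1 = Function.update p.1 k (p.2 k) := by
  funext i
  by_cases h : i = k
  · subst h; simp [sw]
  · simp [sw, h]

theorem sw_sw (S : Finset (Fin n)) (k : Fin n) (h : k ∉ S) (p : (∀ k, Ω k) × (∀ k, Ω k)) :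
    sw {k} (sw S p) = sw (insert k S) p := by
  ext i <;> by_cases hi : i = k
  · subst hi; simp [sw, h]
  · simp [sw, hi]
  · subst hi; simp [sw, h]
  · simp [sw, hi]

theorem sw_sw_comm (S T : Finset (Fin n)) (p : (∀ k, Ω k) × (∀ k, Ω k)) :
    sw S (sw T p) = sw T (sw S p) := by
  ext i <;> by_cases hi : i ∈ S <;> by_cases hj : i ∈ T <;> simp [sw, hi, hj]

theorem sw_self (S : Finset (Fin n)) (p : (∀ k, Ω k) × (∀ k, Ω k)) :
    sw S (sw S p) = p := by
  ext i <;> by_cases hi : i ∈ S <;> simp [sw, hi]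

/-- The first `j` indices. -/
def pre (n j : ℕ) : Finset (Fin n) := Finset.univ.filter fun i => (i : ℕ) < j

theorem pre_succ (k : Fin n) : pre n (k + 1) = insert k (pre n k) := by
  ext i
  simp [pre, Fin.ext_iff]
  omega

theorem integrable_of_bdd {α : Type*} [MeasurableSpace α] (P : Measure α) [IsProbabilityMeasure P]
    {g : α → ℝ} (hg : Measurable g) (C : ℝ) (h : ∀ x, |g x| ≤ C) : Integrable g P :=
  Integrable.of_bound hg.aestronglyMeasurable C (Filter.Eventually.of_forall h)

theorem integral_sw [∀ k, MeasurableSpace (Ω k)]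
    (μ : ∀ k, Measure (Ω k)) [∀ k, IsProbabilityMeasure (μ k)] (S : Finset (Fin n))
    (g : (∀ k, Ω k) × (∀ k, Ω k) → ℝ) (hg : Measurable g) :
    ∫ p, g (sw S p) ∂((Measure.pi μ).prod (Measure.pi μ)) =
      ∫ p, g p ∂((Measure.pi μ).prod (Measure.pi μ)) := by
  have h := mp_sw μ S
  conv_rhs => rw [← h.map_eq]
  rw [integral_map h.measurable.aemeasurable hg.aestronglyMeasurable]

end EfronStein

open EfronStein in
theorem stmt_15 {n : ℕ} {Ω : Fin n → Type*} [∀ k, MeasurableSpace (Ω k)]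
    (μ : ∀ k, Measure (Ω k)) [∀ k, IsProbabilityMeasure (μ k)]
    (f : (∀ k, Ω k) → ℝ) (hf : Measurable f) (C : ℝ) (hb : ∀ x, |f x| ≤ C) :
    ∫ x, (f x - ∫ y, f y ∂(Measure.pi μ)) ^ 2 ∂(Measure.pi μ)
      ≤ (1/2) * ∑ k : Fin n,
          ∫ p, (f p.1 - f (Function.update p.1 k (p.2 k))) ^ 2
            ∂((Measure.pi μ).prod (Measure.pi μ)) := by
  set P := (Measure.pi μ).prod (Measure.pi μ) with hP
  have hm : ∀ S, Measurable fun p : (∀ k, Ω k) × (∀ k, Ω k) => f (sw S p).1 := fun S =>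
    hf.comp (measurable_fst.comp (measurable_sw S))
  have hm1 : Measurable fun p : (∀ k, Ω k) × (∀ k, Ω k) => f p.1 := hf.comp measurable_fst
  have hprod : ∀ g h : (∀ k, Ω k) × (∀ k, Ω k) → ℝ, Measurable g → Measurable h →
      (∃ c, ∀ p, |g p| ≤ c) → (∃ c, ∀ p, |h p| ≤ c) → Integrable (fun p => g p * h p) P := by
    rintro g h hg hh ⟨c, hc⟩ ⟨d, hd⟩
    refine integrable_of_bdd P (hg.mul hh) (c * d) fun p => ?_
    rw [abs_mul]
    exact mul_le_mul (hc p) (hd p) (abs_nonneg _) ((abs_nonneg _).trans (hc p))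
  have hbS : ∀ S, ∃ c, ∀ p : (∀ k, Ω k) × (∀ k, Ω k), |f (sw S p).1| ≤ c :=
    fun S => ⟨C, fun p => hb _⟩
  have hbd : ∀ S T, ∃ c, ∀ p : (∀ k, Ω k) × (∀ k, Ω k), |f (sw S p).1 - f (sw T p).1| ≤ c :=
    fun S T => ⟨C + C, fun p => (abs_sub _ _).trans (add_le_add (hb _) (hb _))⟩
  have sw0 : ∀ p : (∀ k, Ω k) × (∀ k, Ω k), sw ∅ p = p := fun p => by simp [sw]
  have hint : Integrable f (Measure.pi μ) := integrable_of_bdd _ hf C hb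
  have hint2 : Integrable (fun x => f x ^ 2) (Measure.pi μ) :=
    integrable_of_bdd _ (hf.pow_const 2) (C ^ 2) fun x => by
      rw [abs_pow]; exact pow_le_pow_left₀ (abs_nonneg _) (hb x) 2
  -- the sequence of covariances
  let a : ℕ → ℝ := fun j => ∫ p, f (sw ∅ p).1 * f (sw (pre n j) p).1 ∂P
  have ha0 : a 0 = ∫ x, f x ^ 2 ∂(Measure.pi μ) := by
    have h0 : pre n 0 = ∅ := by simp [pre]
    have : a 0 = ∫ p, f p.1 ^ 2 ∂P := by
      simp only [a, h0, sw0, sq]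
    rw [this, hP, integral_fun_fst (fun x => f x ^ 2)]
    simp
  have han : a n = (∫ x, f x ∂(Measure.pi μ)) ^ 2 := by
    have : a n = ∫ p, f p.1 * f p.2 ∂P := by
      have hh : pre n n = Finset.univ := by simp [pre]
      simp only [a, hh, sw0]
      simp [sw]
    rw [this, hP, integral_prod_mul, sq]
  have hvar : ∫ x, (f x - ∫ y, f y ∂(Measure.pi μ)) ^ 2 ∂(Measure.pi μ) = a 0 - a n := by
    rw [ha0, han]
    set m := ∫ y, f y ∂(Measure.pi μ) with hmdef
    have : ∀ x, (f x - m) ^ 2 = f x ^ 2 - 2 * m * f x + m ^ 2 := fun x => by ring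
    simp only [this]
    have hi3 : Integrable (fun x => f x ^ 2 - 2 * m * f x) (Measure.pi μ) :=
      hint2.sub (hint.const_mul _)
    rw [integral_add hi3 (integrable_const _),
      integral_sub hint2 (hint.const_mul _), integral_const_mul, ← hmdef]
    simp
    ring
  have htel : a 0 - a n = ∑ k : Fin n, (a k - a (k + 1)) := by
    rw [Fin.sum_univ_eq_sum_range (fun j => a j - a (j + 1)) n, Finset.sum_range_sub']
  rw [hvar, htel, Finset.mul_sum]
  refine Finset.sum_le_sum fun k _ => ?_
  have hk : k ∉ pre n k := by simp [pre]
  set S := pre n k with hS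
  have hpS : pre n (k + 1) = insert k S := pre_succ k
  have e1 : a k - a (k + 1) =
      ∫ p, f (sw ∅ p).1 * (f (sw S p).1 - f (sw (insert k S) p).1) ∂P := by
    simp only [a, hpS, ← hS, mul_sub]
    rw [integral_sub (hprod _ _ (hm _) (hm _) (hbS _) (hbS _))
      (hprod _ _ (hm _) (hm _) (hbS _) (hbS _))]
  have e2 : a k - a (k + 1) =
      ∫ p, f (sw {k} p).1 * (f (sw (insert k S) p).1 - f (sw S p).1) ∂P := by
    rw [e1, ← integral_sw μ {k}
      (fun p => f (sw ∅ p).1 * (f (sw S p).1 - f (sw (insert k S) p).1)) ((hm _).mul ((hm _).sub (hm _)))]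
    refine integral_congr_ae (Filter.Eventually.of_forall fun p => ?_)
    simp only [sw0, ← sw_sw S k hk]
    rw [sw_sw_comm S {k} p, sw_self]
  have e3 : ∫ p, (f (sw S p).1 - f (sw (insert k S) p).1) ^ 2 ∂P =
      ∫ p, (f (sw ∅ p).1 - f (sw {k} p).1) ^ 2 ∂P := by
    rw [← integral_sw μ S (fun p => (f (sw ∅ p).1 - f (sw {k} p).1) ^ 2)
      (((hm _).sub (hm _)).pow_const 2)]
    simp only [sw0, sw_sw S k hk, hP]
  have e4 : ∫ p, (f p.1 - f (Function.update p.1 k (p.2 k))) ^ 2 ∂P =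
      ∫ p, (f (sw ∅ p).1 - f (sw {k} p).1) ^ 2 ∂P := by
    simp only [sw0, sw_single_fst]
  rw [e4]
  have I : ∀ A B, Integrable (fun p => (f (sw A p).1 - f (sw B p).1) ^ 2) P := fun A B => by
    simp only [sq]
    exact hprod _ _ ((hm _).sub (hm _)) ((hm _).sub (hm _)) (hbd _ _) (hbd _ _)
  have J : ∀ A B D, Integrable (fun p => f (sw A p).1 * (f (sw B p).1 - f (sw D p).1)) P :=
    fun A B D => hprod _ _ (hm _) ((hm _).sub (hm _)) (hbS _) (hbd _ _)
  have e5 : (a k - a (k + 1)) + (a k - a (k + 1)) ≤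
      1 / 2 * ∫ p, (f (sw ∅ p).1 - f (sw {k} p).1) ^ 2 ∂P +
      1 / 2 * ∫ p, (f (sw S p).1 - f (sw (insert k S) p).1) ^ 2 ∂P := by
    nth_rewrite 1 [e1]
    rw [e2, ← integral_add (J _ _ _) (J _ _ _), ← integral_const_mul, ← integral_const_mul,
      ← integral_add ((I _ _).const_mul _) ((I _ _).const_mul _)]
    refine integral_mono ((J _ _ _).add (J _ _ _))
      (((I _ _).const_mul _).add ((I _ _).const_mul _)) fun p => ?_
    simp only
    nlinarith [sq_nonneg ((f (sw ∅ p).1 - f (sw {k} p).1) -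
      (f (sw S p).1 - f (sw (insert k S) p).1))]
  rw [e3] at e5
  linarith
end
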